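/- arXiv:1902.08569 — 2 statements merged into one kernel-verified Lean document; each statement's English description precedes it below -/
import Mathlib

section
/- The products μ_{1;i} and μ_{1;−i} on ℂ³ (where μ_{1;a}(e₁,e₂) = −a·e₂ + e₃, μ_{1;a}(e₂,e₃) = e₁, μ_{1;a}(e₃,e₁) = e₂ + a·e₃) are equivalent under the GL₃(ℂ)-action (g·μ)(x,y) = g(μ(g⁻¹x,g⁻¹y)), and both are equivalent to the product ν given by ν(e₁,e₂) = e₂, ν(e₂,e₃) = e₁, ν(e₃,e₁) = 0. For this product ν, a linear map T = (T_{ij}) belongs to HL(ν) if and only if T₂₁ = T₁₃ and T₃₃ = 0. Moreover, the span of the image ν(ℂ³,ℂ³) is the 2-dimensional subspace spanned by e₁ and e₂, so the Hom-Lie algebras (ℂ³, ν, T) are not perfect. -/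
noncomputable section
open Matrix

abbrev V3 : Type := Fin 3 → ℂ
abbrev Mat3 : Type := Matrix (Fin 3) (Fin 3) ℂ

/-- The cross product on `ℂ³`. -/
def cross3 (x y : V3) : V3 :=
  ![x 1 * y 2 - x 2 * y 1, x 2 * y 0 - x 0 * y 2, x 0 * y 1 - x 1 * y 0]

/-- The skew-symmetric bilinear product on `ℂ³` encoded by the matrix `M`:
`μ(e₂,e₃) = col₀ M`, `μ(e₃,e₁) = col₁ M`, `μ(e₁,e₂) = col₂ M`. -/
def prodOf (M : Mat3) : V3 → V3 → V3 := fun x y => M.mulVec (cross3 x y)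

/-- `T` satisfies the Hom-Lie Jacobi identity for the product `μ`. -/
def HL (μ : V3 → V3 → V3) (T : Mat3) : Prop :=
  ∀ x y z : V3,
    μ (T.mulVec x) (μ y z) + μ (T.mulVec y) (μ z x) + μ (T.mulVec z) (μ x y) = 0

/-- `g` is an invertible automorphism of the product `μ`. -/
def IsAut (μ : V3 → V3 → V3) (g : Mat3) : Prop :=
  g.det ≠ 0 ∧ ∀ x y : V3, g.mulVec (μ x y) = μ (g.mulVec x) (g.mulVec y)

/-- Equivalence of elements of `HL(μ)` under the action `T ↦ g ∘ T ∘ g⁻¹` of `G_μ`. -/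
def HLequiv (μ : V3 → V3 → V3) (T T' : Mat3) : Prop :=
  ∃ g : Mat3, IsAut μ g ∧ T' = g * T * g⁻¹

/-- Equivalence of matrices under the `GL₃(ℂ)`-action `M ↦ (det g)⁻¹ • g * M * gᵀ`. -/
def MEquiv (A B : Mat3) : Prop :=
  ∃ g : Mat3, g.det ≠ 0 ∧ B = (g.det)⁻¹ • (g * A * gᵀ)

/-- Equivalence of products under the `GL₃(ℂ)`-action `(g·μ)(x,y) = g(μ(g⁻¹x, g⁻¹y))`. -/
def ProdEquiv (μ ν : V3 → V3 → V3) : Prop :=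
  ∃ g : Mat3, g.det ≠ 0 ∧ ∀ x y : V3, ν x y = g.mulVec (μ (g⁻¹.mulVec x) (g⁻¹.mulVec y))

/-- The matrix of the product `μ_{1;a}`. -/
def Mone (a : ℂ) : Mat3 := !![1, 0, 0; 0, 1, -a; 0, a, 1]

/-- The matrix of the product `ν`: `ν(e₁,e₂) = e₂`, `ν(e₂,e₃) = e₁`, `ν(e₃,e₁) = 0`. -/
def Mnu : Mat3 := !![1, 0, 0; 0, 0, 1; 0, 0, 0]

/-- A matrix acts on cross products through its cofactors. -/
theorem transpose_mulVec_cross3 (g : Mat3) (x y : V3) :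
    gᵀ.mulVec (cross3 (g.mulVec x) (g.mulVec y)) = g.det • cross3 x y := by
  ext i
  fin_cases i <;>
    simp [cross3, Matrix.mulVec, dotProduct, Fin.sum_univ_three, Matrix.det_fin_three] <;> ring

/-- Equivalent matrices encode equivalent products. -/
theorem MEquiv.prodEquiv {A B : Mat3} (h : MEquiv A B) : ProdEquiv (prodOf A) (prodOf B) := by
  obtain ⟨g, hg, rfl⟩ := h
  refine ⟨g, hg, fun x y => ?_⟩
  have hinv (v : V3) : g.mulVec (g⁻¹.mulVec v) = v := by
    rw [Matrix.mulVec_mulVec, Matrix.mul_nonsing_inv g hg.isUnit, Matrix.one_mulVec]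
  have key := transpose_mulVec_cross3 g (g⁻¹.mulVec x) (g⁻¹.mulVec y)
  rw [hinv, hinv] at key
  simp only [prodOf]
  rw [Matrix.smul_mulVec, ← Matrix.mulVec_mulVec, key, Matrix.mulVec_smul, smul_smul,
    inv_mul_cancel₀ hg, one_smul, Matrix.mulVec_mulVec]

theorem mEquiv_Mone_neg (a : ℂ) : MEquiv (Mone a) (Mone (-a)) := by
  refine ⟨!![-1, 0, 0; 0, 1, 0; 0, 0, -1], by simp [Matrix.det_fin_three], ?_⟩
  ext i j
  fin_cases i <;> fin_cases j <;>
    simp [Mone, Matrix.det_fin_three, Matrix.vecMul, dotProduct, Fin.sum_univ_three]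

theorem mEquiv_Mone_Mnu {a : ℂ} (ha : a ^ 2 = -1) : MEquiv (Mone a) Mnu := by
  have hdet : (!![-2 * a, 0, 0; 0, 1, -a; 0, -1, -a] : Mat3).det = -4 := by
    simp [Matrix.det_fin_three]
    linear_combination 4 * ha
  refine ⟨!![-2 * a, 0, 0; 0, 1, -a; 0, -1, -a], by rw [hdet]; norm_num, ?_⟩
  rw [hdet]
  ext i j
  fin_cases i <;> fin_cases j <;>
    simp [Mone, Mnu, Matrix.vecMul, dotProduct, Fin.sum_univ_three] <;> grind

theorem HL_prodOf_Mnu_iff (T : Mat3) :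
    HL (prodOf Mnu) T ↔ (T 1 0 = T 0 2 ∧ T 2 2 = 0) := by
  constructor
  · intro h
    have h := h (Pi.single 0 1) (Pi.single 1 1) (Pi.single 2 1)
    have h0 := congrFun h 0
    have h1 := congrFun h 1
    simp [prodOf, Mnu, cross3, Matrix.mulVec, dotProduct, Fin.sum_univ_three] at h0 h1
    exact ⟨by linear_combination -h1, h0⟩
  · rintro ⟨h1, h2⟩ x y z
    ext i
    fin_cases i <;>
      simp [prodOf, Mnu, cross3, Matrix.mulVec, dotProduct, Fin.sum_univ_three, h1, h2] <;> ring

theorem span_range_prodOf_Mnu :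
    Submodule.span ℂ {v : V3 | ∃ x y : V3, prodOf Mnu x y = v}
      = Submodule.span ℂ ({Pi.single 0 1, Pi.single 1 1} : Set V3) := by
  apply le_antisymm <;> rw [Submodule.span_le]
  · rintro _ ⟨x, y, rfl⟩
    refine Submodule.mem_span_pair.2 ⟨prodOf Mnu x y 0, prodOf Mnu x y 1, ?_⟩
    ext i
    fin_cases i <;> simp [prodOf, Mnu, Matrix.mulVec, dotProduct, Fin.sum_univ_three]
  · rintro _ (rfl | rfl) <;> apply Submodule.subset_span
    · refine ⟨Pi.single 1 1, Pi.single 2 1, ?_⟩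
      ext i
      fin_cases i <;> simp [prodOf, Mnu, cross3, Matrix.mulVec, dotProduct, Fin.sum_univ_three]
    · refine ⟨Pi.single 0 1, Pi.single 1 1, ?_⟩
      ext i
      fin_cases i <;> simp [prodOf, Mnu, cross3, Matrix.mulVec, dotProduct, Fin.sum_univ_three]

theorem span_range_prodOf_Mnu_ne_top :
    Submodule.span ℂ {v : V3 | ∃ x y : V3, prodOf Mnu x y = v} ≠ ⊤ := by
  intro h
  have hmem : (Pi.single 2 1 : V3) ∈ (⊤ : Submodule ℂ V3) := Submodule.mem_top
  rw [← h, span_range_prodOf_Mnu, Submodule.mem_span_pair] at hmem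
  obtain ⟨a, b, hab⟩ := hmem
  simpa using congrFun hab 2

theorem stmt7 :
    ProdEquiv (prodOf (Mone Complex.I)) (prodOf (Mone (-Complex.I))) ∧
    ProdEquiv (prodOf (Mone Complex.I)) (prodOf Mnu) ∧
    ProdEquiv (prodOf (Mone (-Complex.I))) (prodOf Mnu) ∧
    (∀ T : Mat3, HL (prodOf Mnu) T ↔ (T 1 0 = T 0 2 ∧ T 2 2 = 0)) ∧
    Submodule.span ℂ {v : V3 | ∃ x y : V3, prodOf Mnu x y = v}
      = Submodule.span ℂ ({Pi.single 0 1, Pi.single 1 1} : Set V3) ∧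
    Submodule.span ℂ {v : V3 | ∃ x y : V3, prodOf Mnu x y = v} ≠ ⊤ := by
  exact ⟨(mEquiv_Mone_neg _).prodEquiv, (mEquiv_Mone_Mnu Complex.I_sq).prodEquiv,
    (mEquiv_Mone_Mnu (by simp)).prodEquiv, HL_prodOf_Mnu_iff, span_range_prodOf_Mnu,
    span_range_prodOf_Mnu_ne_top⟩
end
end

section
/- Let μ″₄ be the product on ℂ³ given by μ″₄(e₁,e₂) = e₂, μ″₄(e₂,e₃) = 0, μ″₄(e₃,e₁) = i·e₃. Then a linear map T = (T_{ij}) belongs to HL(μ″₄) if and only if T₁₂ = 0 and T₁₃ = 0. Moreover, writing Θ = [[T₂₂,T₂₃],[T₃₂,T₃₃]] for the lower-right 2×2 block of such a T: if det(Θ − T₁₁·1₂) ≠ 0, then T is equivalent under the G_{μ″₄}-action T ↦ g∘T∘g⁻¹ to some T′ ∈ HL(μ″₄) with T′₂₁ = T′₃₁ = 0 (i.e., to a block-diagonal map with blocks T₁₁ and a 2×2 matrix). -/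
noncomputable section
open Matrix

/-- The matrix of the product `μ″₄`:
`μ″₄(e₁,e₂) = e₂`, `μ″₄(e₂,e₃) = 0`, `μ″₄(e₃,e₁) = i·e₃`. -/
def Md24 : Mat3 := !![0, 0, 0; 0, 0, 1; 0, Complex.I, 0]

/-- The lower-right `2×2` block `Θ` of `T`. -/
def thetaLR (T : Mat3) : Matrix (Fin 2) (Fin 2) ℂ := !![T 1 1, T 1 2; T 2 1, T 2 2]

theorem prodOf_Md24 (x y : V3) :
    prodOf Md24 x y = ![0, x 0 * y 1 - x 1 * y 0, Complex.I * (x 2 * y 0 - x 0 * y 2)] := by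
  ext i
  fin_cases i <;> simp [prodOf, cross3, Md24, Matrix.mulVec, dotProduct, Fin.sum_univ_three]

theorem HL_prodOf_Md24_iff (T : Mat3) : HL (prodOf Md24) T ↔ T 0 1 = 0 ∧ T 0 2 = 0 := by
  constructor
  · intro h
    have h' := h ![1, 0, 0] ![0, 1, 0] ![0, 0, 1]
    have h1 := congrFun h' 1
    have h2 := congrFun h' 2
    simp [prodOf_Md24, Matrix.mulVec, dotProduct, Fin.sum_univ_three] at h1 h2
    exact ⟨h2, h1⟩
  · rintro ⟨h1, h2⟩ x y z
    ext i
    fin_cases i <;>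
      simp [prodOf_Md24, Matrix.mulVec, dotProduct, Fin.sum_univ_three, h1, h2] <;> ring

/-- The shear fixing `e₂`, `e₃` and sending `e₁` to `e₁ + a e₂ + b e₃`. -/
def shear (a b : ℂ) : Mat3 := !![1, 0, 0; a, 1, 0; b, 0, 1]

theorem det_shear (a b : ℂ) : (shear a b).det = 1 := by
  simp [shear, Matrix.det_fin_three]

theorem isAut_shear (a b : ℂ) : IsAut (prodOf Md24) (shear a b) := by
  refine ⟨by simp [det_shear], fun x y => ?_⟩
  ext i
  fin_cases i <;>
    simp [prodOf_Md24, shear, Matrix.mulVec, dotProduct, Fin.sum_univ_three] <;> ring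

theorem HLequiv_of_mul_eq_mul {μ : V3 → V3 → V3} {T T' g : Mat3} (hg : IsAut μ g)
    (h : T' * g = g * T) : HLequiv μ T T' := by
  refine ⟨g, hg, ?_⟩
  rw [← h, Matrix.mul_nonsing_inv_cancel_right _ _ (isUnit_iff_ne_zero.mpr hg.1)]

theorem stmt16 :
    (∀ T : Mat3, HL (prodOf Md24) T ↔ (T 0 1 = 0 ∧ T 0 2 = 0)) ∧
    (∀ T : Mat3, HL (prodOf Md24) T →
      (thetaLR T - T 0 0 • (1 : Matrix (Fin 2) (Fin 2) ℂ)).det ≠ 0 →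
      ∃ q s w r : ℂ, HLequiv (prodOf Md24) T !![T 0 0, 0, 0; 0, q, s; 0, w, r]) := by
  refine ⟨HL_prodOf_Md24_iff, fun T hT hdet => ?_⟩
  obtain ⟨h1, h2⟩ := (HL_prodOf_Md24_iff T).mp hT
  set D := (thetaLR T - T 0 0 • (1 : Matrix (Fin 2) (Fin 2) ℂ)).det with hD
  have hD' : D = (T 1 1 - T 0 0) * (T 2 2 - T 0 0) - T 1 2 * T 2 1 := by
    simp [hD, thetaLR, Matrix.det_fin_two]
  set a := ((T 2 2 - T 0 0) * T 1 0 - T 1 2 * T 2 0) / D with ha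
  set b := ((T 1 1 - T 0 0) * T 2 0 - T 2 1 * T 1 0) / D with hb
  have e1 : T 1 1 * a + T 1 2 * b = a * T 0 0 + T 1 0 := by
    rw [ha, hb]
    field_simp
    rw [hD']
    ring
  have e2 : T 2 1 * a + T 2 2 * b = b * T 0 0 + T 2 0 := by
    rw [ha, hb]
    field_simp
    rw [hD']
    ring
  refine ⟨T 1 1, T 1 2, T 2 1, T 2 2, HLequiv_of_mul_eq_mul (isAut_shear a b) ?_⟩
  ext i j
  fin_cases i <;> fin_cases j <;>
    simp [shear, Matrix.mul_apply, Fin.sum_univ_three, h1, h2, e1, e2]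
end
end
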